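/- Let R be a valuation ring (an integral domain in which for any two elements one divides the other) and let M be a torsion-free R-module. Then for every n ≥ 1, the n-th exterior power ⋀ⁿ_R M is a torsion-free R-module. -/

import Mathlib

open Classical in
noncomputable def extAuxLift (R : Type) [CommRing R] (M : Type) [AddCommGroup M] [Module R M]
    (n : ℕ) (N : Submodule R M) : ((Fin n → M) →₀ R) →ₗ[R] ⋀[R]^n N :=
  Finsupp.linearCombination R (fun m : Fin n → M =>
    if h : ∀ i, m i ∈ N then exteriorPower.ιMulti R n (fun i => (⟨m i, h i⟩ : N)) else 0)

theorem extAuxLift_single (R : Type) [CommRing R] (M : Type) [AddCommGroup M] [Module R M]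
    (n : ℕ) (N : Submodule R M) (m : Fin n → M) (h : ∀ i, m i ∈ N) (r : R) :
    extAuxLift R M n N (Finsupp.single m r) =
      r • exteriorPower.ιMulti R n (fun i => (⟨m i, h i⟩ : N)) := by
  simp [extAuxLift, h]

def extAuxSub (R : Type) [CommRing R] (M : Type) [AddCommGroup M] [Module R M]
    (n : ℕ) : Submodule R ((Fin n → M) →₀ R) where
  carrier := {z | ∃ N₀ : Submodule R M, N₀.FG ∧ ∀ N, N₀ ≤ N → extAuxLift R M n N z = 0}
  zero_mem' := ⟨⊥, Submodule.fg_bot, by simp⟩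
  add_mem' := by
    rintro a b ⟨N, hN, h⟩ ⟨N', hN', h'⟩
    refine ⟨N ⊔ N', hN.sup hN', fun P hP => ?_⟩
    rw [map_add, h P (le_sup_left.trans hP), h' P (le_sup_right.trans hP), add_zero]
  smul_mem' := by
    rintro c a ⟨N, hN, h⟩
    exact ⟨N, hN, fun P hP => by rw [map_smul, h P hP, smul_zero]⟩

theorem extAux_update {R : Type} [CommRing R] {M : Type} [AddCommGroup M] [Module R M]
    {n : ℕ} {N : Submodule R M} [DecidableEq (Fin n)] {m : Fin n → M} (hm : ∀ i, m i ∈ N)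
    (i : Fin n) {x : M} (hx : x ∈ N) : ∀ j, Function.update m i x j ∈ N := by
  intro j
  by_cases h : j = i
  · subst h; simpa using hx
  · simpa [h] using hm j

theorem extAuxLift_update (R : Type) [CommRing R] (M : Type) [AddCommGroup M] [Module R M]
    (n : ℕ) (N : Submodule R M) [DecidableEq (Fin n)] (m : Fin n → M) (hm : ∀ i, m i ∈ N)
    (i : Fin n) (x : M) (hx : x ∈ N) (r : R) :
    extAuxLift R M n N (Finsupp.single (Function.update m i x) r) =
      r • exteriorPower.ιMulti R n
        (Function.update (fun i => (⟨m i, hm i⟩ : N)) i ⟨x, hx⟩) := by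
  rw [extAuxLift_single R M n N _ (extAux_update hm i hx)]
  congr 2
  funext j
  by_cases h : j = i
  · subst h; simp
  · simp [h]

noncomputable def extAuxAlt (R : Type) [CommRing R] (M : Type) [AddCommGroup M] [Module R M]
    (n : ℕ) : M [⋀^Fin n]→ₗ[R] (((Fin n → M) →₀ R) ⧸ extAuxSub R M n) where
  toFun m := (extAuxSub R M n).mkQ (Finsupp.single m 1)
  map_update_add' := by
    intro _ m i x y
    rw [← map_add, ← sub_eq_zero, ← map_sub, Submodule.mkQ_apply, Submodule.Quotient.mk_eq_zero]
    refine ⟨Submodule.span R (Set.range m ∪ {x, y}),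
      Submodule.fg_span ((Set.finite_range m).union (by simp)), fun N hN => ?_⟩
    rw [Submodule.span_le] at hN
    have hm : ∀ i, m i ∈ N := fun i => hN (Or.inl ⟨i, rfl⟩)
    have hx : x ∈ N := hN (Or.inr (by simp))
    have hy : y ∈ N := hN (Or.inr (by simp))
    rw [map_sub, map_add, extAuxLift_update R M n N m hm i _ (N.add_mem hx hy),
      extAuxLift_update R M n N m hm i _ hx, extAuxLift_update R M n N m hm i _ hy,
      sub_eq_zero, one_smul, one_smul, one_smul, ← AlternatingMap.map_update_add]
    rfl
  map_update_smul' := by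
    intro _ m i c x
    rw [← map_smul, ← sub_eq_zero, ← map_sub, Submodule.mkQ_apply, Submodule.Quotient.mk_eq_zero]
    refine ⟨Submodule.span R (Set.range m ∪ {x}),
      Submodule.fg_span ((Set.finite_range m).union (by simp)), fun N hN => ?_⟩
    rw [Submodule.span_le] at hN
    have hm : ∀ i, m i ∈ N := fun i => hN (Or.inl ⟨i, rfl⟩)
    have hx : x ∈ N := hN (Or.inr (by simp))
    rw [map_sub, map_smul, extAuxLift_update R M n N m hm i _ (N.smul_mem c hx),
      extAuxLift_update R M n N m hm i _ hx,
      sub_eq_zero, one_smul, one_smul, ← AlternatingMap.map_update_smul]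
    rfl
  map_eq_zero_of_eq' := by
    intro m i j hij hne
    rw [Submodule.mkQ_apply, Submodule.Quotient.mk_eq_zero]
    refine ⟨Submodule.span R (Set.range m),
      Submodule.fg_span (Set.finite_range m), fun N hN => ?_⟩
    rw [Submodule.span_le] at hN
    have hm : ∀ i, m i ∈ N := fun i => hN ⟨i, rfl⟩
    rw [extAuxLift_single R M n N m hm, AlternatingMap.map_eq_zero_of_eq _ _ _ hne, smul_zero]
    exact Subtype.ext hij

theorem extAux_mem (R : Type) [CommRing R] (M : Type) [AddCommGroup M] [Module R M]
    (n : ℕ) (z : (Fin n → M) →₀ R)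
    (hz : Finsupp.linearCombination R (exteriorPower.ιMulti R n (M := M)) z = 0) :
    z ∈ extAuxSub R M n := by
  have key : (exteriorPower.alternatingMapLinearEquiv (extAuxAlt R M n)) ∘ₗ
      (Finsupp.linearCombination R (exteriorPower.ιMulti R n (M := M))) =
      (extAuxSub R M n).mkQ := by
    ext m
    simp [extAuxAlt]
  have := LinearMap.congr_fun key z
  rw [LinearMap.comp_apply, hz, map_zero] at this
  rw [← Submodule.Quotient.mk_eq_zero]
  exact this.symm

theorem extAux_map (R : Type) [CommRing R] (M : Type) [AddCommGroup M] [Module R M]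
    (n : ℕ) (N : Submodule R M) (z : (Fin n → M) →₀ R)
    (hz : ∀ m ∈ z.support, ∀ i, m i ∈ N) :
    exteriorPower.map n N.subtype (extAuxLift R M n N z) =
      Finsupp.linearCombination R (exteriorPower.ιMulti R n (M := M)) z := by
  conv_lhs => rw [← Finsupp.sum_single z]
  rw [Finsupp.linearCombination_apply, Finsupp.sum, Finsupp.sum, map_sum, map_sum]
  refine Finset.sum_congr rfl fun m hm => ?_
  rw [extAuxLift_single R M n N m (hz m hm), map_smul, exteriorPower.map_apply_ιMulti]
  rfl

/-- Over a valuation ring `R` (an integral domain in which, for any two elements,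
one divides the other), the `n`-th exterior power of a torsion-free `R`-module is
torsion-free for every `n ≥ 1`. -/
theorem exteriorPower_torsionFree_of_valuationRing
    (R : Type) [CommRing R] [IsDomain R] [ValuationRing R]
    (M : Type) [AddCommGroup M] [Module R M] [NoZeroSMulDivisors R M]
    (n : ℕ) (hn : 1 ≤ n) :
    NoZeroSMulDivisors R (⋀[R]^n M) := by
  refine ⟨fun {r x} hrx => ?_⟩
  by_cases hr : r = 0
  · exact Or.inl hr
  right
  have hsurj : ∃ z, Finsupp.linearCombination R (exteriorPower.ιMulti R n (M := M)) z = x := by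
    have : x ∈ LinearMap.range
        (Finsupp.linearCombination R (exteriorPower.ιMulti R n (M := M))) := by
      rw [Finsupp.range_linearCombination, exteriorPower.ιMulti_span]
      trivial
    exact this
  obtain ⟨z, rfl⟩ := hsurj
  rw [← map_smul] at hrx
  obtain ⟨N₀, hN₀, h⟩ := extAux_mem R M n _ hrx
  let T : Set M := ⋃ m ∈ z.support, Set.range m
  have hT : T.Finite := z.support.finite_toSet.biUnion fun m _ => Set.finite_range m
  let N := N₀ ⊔ Submodule.span R T
  have hN : N.FG := hN₀.sup (Submodule.fg_span hT)
  have h1 := h N le_sup_left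
  have : Module.Finite R N := Module.Finite.iff_fg.mpr hN
  have : Module.Flat R N := by
    rw [Module.Flat.flat_iff_torsion_eq_bot_of_isBezout, eq_bot_iff]
    rintro y ⟨⟨a, ha⟩, hay⟩
    have hay' : a • (y : M) = 0 := congrArg Subtype.val hay
    have := (NoZeroSMulDivisors.eq_zero_or_eq_zero_of_smul_eq_zero hay').resolve_left
      (nonZeroDivisors.ne_zero ha)
    exact (Submodule.mem_bot R).mpr (Subtype.ext this)
  have : Module.Free R N := Module.free_of_flat_of_isLocalRing
  rw [map_smul] at h1
  have h2 : extAuxLift R M n N z = 0 := (smul_eq_zero.mp h1).resolve_left hr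
  rw [← extAux_map R M n N z, h2, map_zero]
  intro m hm i
  refine Submodule.mem_sup_right (Submodule.subset_span ?_)
  exact Set.mem_biUnion hm ⟨i, rfl⟩
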